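/- arXiv:2410.08179 — 4 statements merged into one kernel-verified Lean document; each statement's English description precedes it below -/
import Mathlib

section
/- Let n ≥ 2 and k ≥ 1. Let V₁ ⊊ V₂ ⊊ … ⊊ V_k be linear subspaces of ℝⁿ with V₁ ≠ 0 and V_k ≠ ℝⁿ, and let W₁, …, W_k be linear subspaces of ℝⁿ with dim W_i = n − dim V_i and V_i ∩ W_i = {0} for all i (so each W_i is a complement of V_i, and W_k ⊊ … ⊊ W₁). Let P = {g ∈ SL(n,ℝ) : g·V_i = V_i for all i} and P⁻ = {g ∈ SL(n,ℝ) : g·W_i = W_i for all i}; these form a pair of opposite proper parabolic subgroups of SL(n,ℝ). Then there is no discrete subgroup Γ of P × P⁻ whose action on SL(n,ℝ) by (p,q)·x = p x q⁻¹ is properly discontinuous and cocompact. (The last statement of Theorem 7.1 for G = SL(n,ℝ).) -/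
open Matrix

/-- `SL(n,ℝ)` with its matrix topology. -/
instance (n : ℕ) : TopologicalSpace (SpecialLinearGroup (Fin n) ℝ) :=
  TopologicalSpace.induced (fun g => (g : Matrix (Fin n) (Fin n) ℝ)) inferInstance

open MeasureTheory Measure in
/-- An equivariant self-map of a measure space with a measure-preserving action of finite
covolume cannot rescale the measure. -/
theorem eq_one_of_map_eq_smul_of_finite_covolume {Γ X : Type*} [Group Γ] [Countable Γ]
    [MeasurableSpace X] [MulAction Γ X] [MeasurableConstSMul Γ X] {ν : Measure X}
    [SMulInvariantMeasure Γ X ν] {C : Set X} (hC : MeasurableSet C) (hCν : ν C ≠ ⊤) (hν : ν ≠ 0)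
    (hne : ∀ᵐ x ∂ν, {γ : Γ | γ • x ∈ C}.Nonempty) (hfin : ∀ᵐ x ∂ν, {γ : Γ | γ • x ∈ C}.Finite)
    {φ : X → X} (hφ : Measurable φ) (hcomm : ∀ᵐ x ∂ν, ∀ γ : Γ, φ (γ • x) = γ • φ x)
    {c : ENNReal} (hmap : ν.map φ = c • ν) : c = 1 := by
  let N : X → ENNReal := fun x => ∑' γ : Γ, C.indicator 1 (γ • x)
  let w : X → ENNReal := fun x => C.indicator 1 x * (N x)⁻¹
  have hind : Measurable (C.indicator (1 : X → ENNReal)) := measurable_one.indicator hC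
  have hNm : Measurable N :=
    Measurable.tsum fun γ => hind.comp (measurable_const_smul γ)
  have hwm : Measurable w := hind.mul hNm.inv
  have hNinv : ∀ (γ : Γ) x, N (γ • x) = N x := fun γ x => by
    simp only [N, ← mul_smul]
    exact (Equiv.mulRight γ).tsum_eq (fun δ : Γ => C.indicator (1 : X → ENNReal) (δ • x))
  have hsum : ∀ᵐ x ∂ν, ∑' γ : Γ, w (γ • x) = 1 := by
    filter_upwards [hne, hfin] with x ⟨γ, hγ⟩ hx
    simp only [w, hNinv]
    rw [ENNReal.tsum_mul_right]
    refine ENNReal.mul_inv_cancel ?_ ?_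
    · refine ENNReal.tsum_eq_zero.not.2 fun h => ?_
      have := h γ
      have hx : γ • x ∈ C := hγ
      simp [hx] at this
    · rw [tsum_eq_sum (s := hx.toFinset) fun δ hδ => Set.indicator_of_notMem (by simpa using hδ) _]
      refine ENNReal.sum_ne_top.2 fun δ _ => ?_
      by_cases h : δ • x ∈ C <;> simp [h]
  have key : ∀ u : X → ENNReal, Measurable u → (∀ᵐ x ∂ν, ∑' γ : Γ, u (γ • x) = 1) →
      ∫⁻ x, u x ∂ν = ∫⁻ x, w x ∂ν := by
    intro u hu husum
    have swap : ∀ γ : Γ, ∫⁻ x, u x * w (γ • x) ∂ν = ∫⁻ x, w x * u (γ⁻¹ • x) ∂ν := fun γ => by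
      rw [← (measurePreserving_smul γ ν).lintegral_comp
        (f := fun x => w x * u (γ⁻¹ • x)) (hwm.mul (hu.comp (measurable_const_smul _)))]
      simp [mul_comm]
    calc ∫⁻ x, u x ∂ν = ∫⁻ x, ∑' γ : Γ, u x * w (γ • x) ∂ν := by
          refine lintegral_congr_ae ?_
          filter_upwards [hsum] with x hx
          rw [ENNReal.tsum_mul_left, hx, mul_one]
      _ = ∑' γ : Γ, ∫⁻ x, w x * u (γ⁻¹ • x) ∂ν := by
          rw [lintegral_tsum (f := fun γ x => u x * w (γ • x)) fun γ =>
            (hu.mul (hwm.comp (measurable_const_smul γ))).aemeasurable]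
          exact tsum_congr swap
      _ = ∑' γ : Γ, ∫⁻ x, w x * u (γ • x) ∂ν :=
          (Equiv.inv Γ).tsum_eq (fun γ : Γ => ∫⁻ x, w x * u (γ • x) ∂ν)
      _ = ∫⁻ x, w x ∂ν := by
          rw [← lintegral_tsum (f := fun γ x => w x * u (γ • x)) fun γ =>
            (hwm.mul (hu.comp (measurable_const_smul γ))).aemeasurable]
          refine lintegral_congr_ae ?_
          filter_upwards [husum] with x hx
          rw [ENNReal.tsum_mul_left, hx, mul_one]
  have hφsum : c ≠ 0 → ∀ᵐ x ∂ν, ∑' γ : Γ, w (φ (γ • x)) = 1 := fun hc => by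
    have : ∀ᵐ x ∂(ν.map φ), ∑' γ : Γ, w (γ • x) = 1 := by
      rw [hmap]
      exact ae_smul_measure hsum c
    filter_upwards [ae_of_ae_map hφ.aemeasurable this, hcomm] with x hx hx'
    simpa only [hx'] using hx
  have hwpos : ∫⁻ x, w x ∂ν ≠ 0 := fun h => by
    refine hν (measure_univ_eq_zero.1 ?_)
    calc ν Set.univ = ∫⁻ x, ∑' γ : Γ, w (γ • x) ∂ν := by
          rw [lintegral_congr_ae hsum, lintegral_one]
      _ = ∑' γ : Γ, ∫⁻ x, w (γ • x) ∂ν :=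
          lintegral_tsum fun γ => (hwm.comp (measurable_const_smul γ)).aemeasurable
      _ = 0 := by
          refine ENNReal.tsum_eq_zero.2 fun γ => ?_
          rw [(measurePreserving_smul γ ν).lintegral_comp hwm, h]
  have hwfin : ∫⁻ x, w x ∂ν ≠ ⊤ := by
    refine ne_top_of_le_ne_top hCν ?_
    rw [← lintegral_indicator_one hC]
    refine lintegral_mono fun x => ?_
    by_cases hx : x ∈ C
    · have : 1 ≤ N x := by
        refine le_trans ?_ (ENNReal.le_tsum (1 : Γ))
        simp [hx]
      simpa [w, hx] using this
    · simp [w, hx]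
  have hc0 : c ≠ 0 := by
    rintro rfl
    rw [zero_smul] at hmap
    exact hν ((map_eq_zero_iff hφ.aemeasurable).1 hmap)
  have h1 := key (fun x => w (φ x)) (hwm.comp hφ) (hφsum hc0)
  rw [← lintegral_map hwm hφ, hmap, lintegral_smul_measure, smul_eq_mul] at h1
  exact (ENNReal.mul_left_inj hwpos hwfin).1 (by rw [h1, one_mul])

theorem LinearMap.det_mulLeftRight_matrix {ι : Type*} [Fintype ι] [DecidableEq ι]
    (a b : Matrix ι ι ℝ) :
    LinearMap.det (LinearMap.mulLeftRight ℝ (a, b)) = (a.det * b.det) ^ Fintype.card ι := by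
  let e : Matrix ι ι ℝ ≃ₗ[ℝ] (ι × ι → ℝ) := .ofBijective
    { toFun := vec, map_add' := vec_add, map_smul' := vec_smul } vec_bijective
  have h : (e : Matrix ι ι ℝ →ₗ[ℝ] (ι × ι → ℝ)) ∘ₗ LinearMap.mulLeftRight ℝ (a, b) ∘ₗ
      (e.symm : (ι × ι → ℝ) →ₗ[ℝ] Matrix ι ι ℝ) = Matrix.toLin' (kroneckerMap (· * ·) bᵀ a) := by
    refine LinearMap.ext fun v => ?_
    obtain ⟨x, rfl⟩ := e.surjective v
    rw [Matrix.toLin'_apply]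
    refine Eq.trans ?_ (kronecker_mulVec_vec a x bᵀ).symm
    change vec (a * e.symm (e x) * b) = _
    rw [e.symm_apply_apply, transpose_transpose]
  rw [← LinearMap.det_conj _ e, h, LinearMap.det_toLin', det_kronecker,
    det_transpose, mul_pow, mul_comm]

section Block

open MeasureTheory

/-- The space of entries of a real matrix. -/
abbrev Entries (m n : Type) : Type := m → n → ℝ

/-- The blocks `(B, C, D)` of a block matrix `fromBlocks A B C D`. -/
abbrev OuterBlocks (m l : Type) : Type := Entries m l × Entries l m × Entries l l

/-- The blocks `((B, C, D), A)` of a block matrix `fromBlocks A B C D`. -/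
abbrev Blocks (m l : Type) : Type := OuterBlocks m l × Entries m m

local instance {m n : Type} [Fintype m] [Fintype n] :
    (volume : Measure (Entries m n)).IsAddHaarMeasure :=
  Measure.pi.isAddHaarMeasure _

local instance {m l : Type} [Fintype m] [Fintype l] :
    (volume : Measure (Entries l m × Entries l l)).IsAddHaarMeasure :=
  Measure.prod.instIsAddHaarMeasure _ _

local instance {m l : Type} [Fintype m] [Fintype l] :
    MeasurableConstSMul ℝ (OuterBlocks m l) :=
  ContinuousConstSMul.toMeasurableConstSMul

local instance {m l : Type} [Fintype m] [Fintype l] : MeasurableAdd (OuterBlocks m l) :=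
  ⟨fun c => (continuous_const_add c).measurable, fun c => (continuous_add_const c).measurable⟩

local instance {m l : Type} [Fintype m] [Fintype l] :
    (volume : Measure (OuterBlocks m l)).IsAddHaarMeasure :=
  Measure.prod.instIsAddHaarMeasure _ _

local instance {m l : Type} [Fintype m] [Fintype l] :
    (volume : Measure (Blocks m l)).IsAddHaarMeasure :=
  Measure.prod.instIsAddHaarMeasure _ _

local instance {m l : Type} [Fintype m] [Fintype l] : BorelSpace (OuterBlocks m l) :=
  Prod.borelSpace

local instance {m l : Type} [Fintype m] [Fintype l] : BorelSpace (Blocks m l) :=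
  Prod.borelSpace

/-- Assembling a block matrix, as a linear equivalence. -/
def blocksEquiv (m l : Type) : Blocks m l ≃ₗ[ℝ] Matrix (m ⊕ l) (m ⊕ l) ℝ where
  toFun x := fromBlocks (of x.2) (of x.1.1) (of x.1.2.1) (of x.1.2.2)
  invFun M := ((of.symm M.toBlocks₁₂, of.symm M.toBlocks₂₁, of.symm M.toBlocks₂₂),
    of.symm M.toBlocks₁₁)
  map_add' x y := by rw [fromBlocks_add]; rfl
  map_smul' r x := by rw [RingHom.id_apply, fromBlocks_smul]; rfl
  left_inv _ := rfl
  right_inv M := fromBlocks_toBlocks M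

theorem blocksEquiv_apply {m l : Type} (x : Blocks m l) :
    blocksEquiv m l x = fromBlocks (of x.2) (of x.1.1) (of x.1.2.1) (of x.1.2.2) :=
  rfl

variable {m l : Type} [Fintype m] [Fintype l] [DecidableEq l]

/-- `B D⁻¹ C` for `z = (B, C, D)`. -/
noncomputable def schurTerm {m l : Type} [Fintype l] [DecidableEq l]
    (z : OuterBlocks m l) : Entries m m :=
  of.symm (of z.1 * (of z.2.2)⁻¹ * of z.2.1)

theorem measurable_schurTerm {m l : Type} [Fintype m] [Fintype l] [DecidableEq l] : Measurable (schurTerm (m := m) (l := l)) := by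
  have h1 : Continuous fun z : OuterBlocks m l => det (of z.2.2) :=
    Continuous.matrix_det (continuous_snd.comp continuous_snd)
  have h2 : Continuous fun z : OuterBlocks m l =>
      of.symm (of z.1 * adjugate (of z.2.2) * of z.2.1) :=
    (Continuous.matrix_mul continuous_fst
      (continuous_snd.comp continuous_snd).matrix_adjugate).matrix_mul
        (continuous_fst.comp continuous_snd)
  have : schurTerm (m := m) (l := l) = fun z => (det (of z.2.2))⁻¹ •
      of.symm (of z.1 * adjugate (of z.2.2) * of z.2.1) := by
    funext z
    simp only [schurTerm, Matrix.inv_def, Ring.inverse_eq_inv', Matrix.mul_smul, Matrix.smul_mul]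
    rfl
  rw [this]
  exact h1.measurable.inv.smul h2.measurable

/-- Rescaling the Schur complement `A - B D⁻¹ C` by `a` and the blocks `B`, `C`, `D` by `d`. -/
noncomputable def schurScale (a d : ℝ) (x : Blocks m l) : Blocks m l :=
  (d • x.1, a • (x.2 - schurTerm x.1) + d • schurTerm x.1)

theorem measurePreserving_shear {m l : Type} [Fintype m] [Fintype l]
    {g : OuterBlocks m l → Entries m m} (hg : Measurable g) :
    MeasurePreserving (fun x : Blocks m l => (x.1, x.2 + g x.1)) :=
  (MeasurePreserving.id volume).skew_product (g := fun z A => A + g z)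
    (measurable_snd.add (hg.comp measurable_fst))
    (ae_of_all _ fun z => (measurePreserving_add_right volume (g z)).map_eq)

theorem measurable_schurScale (a d : ℝ) : Measurable (schurScale (m := m) (l := l) a d) := by
  have : Measurable fun x : Blocks m l => schurTerm x.1 :=
    measurable_schurTerm.comp measurable_fst
  exact (measurable_fst.const_smul d).prodMk
    (((measurable_snd.sub this).const_smul a).add (this.const_smul d))

theorem map_schurScale {a d : ℝ} (ha : a ≠ 0) (hd : d ≠ 0) :
    (volume : Measure (Blocks m l)).map (schurScale a d) =
      ENNReal.ofReal |((d ^ (2 * (Fintype.card m * Fintype.card l) +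
        Fintype.card l * Fintype.card l)) * a ^ (Fintype.card m * Fintype.card m))⁻¹| •
          volume := by
  have h1 := measurePreserving_shear (measurable_schurTerm (m := m) (l := l)).neg
  have h2 := measurePreserving_shear (m := m) (l := l) (g := fun z => d • schurTerm (d⁻¹ • z))
    ((measurable_schurTerm.comp (measurable_const_smul d⁻¹)).const_smul d)
  have hscale : (volume : Measure (Blocks m l)).map (Prod.map (d • ·) (a • ·)) = 
      ENNReal.ofReal |((d ^ (2 * (Fintype.card m * Fintype.card l) +
        Fintype.card l * Fintype.card l)) * a ^ (Fintype.card m * Fintype.card m))⁻¹| •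
          volume := by
    rw [Measure.volume_eq_prod, ← Measure.map_prod_map _ _ (measurable_const_smul d)
      (measurable_const_smul a), Measure.map_addHaar_smul _ hd, Measure.map_addHaar_smul _ ha,
      Measure.prod_smul_left, Measure.prod_smul_right, smul_smul,
      ← ENNReal.ofReal_mul (abs_nonneg _), ← abs_mul, ← mul_inv]
    congr 6
    · simp [Module.finrank_prod, Module.finrank_pi_fintype]
      ring
    · simp [Module.finrank_pi_fintype]
  have hcomp : schurScale (m := m) (l := l) a d =
      (fun x => (x.1, x.2 + d • schurTerm (d⁻¹ • x.1))) ∘ Prod.map (d • ·) (a • ·) ∘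
        (fun x => (x.1, x.2 + (-schurTerm) x.1)) := by
    funext x
    simp [schurScale, smul_smul, hd, sub_eq_add_neg]
  have hsm : Measurable (Prod.map (d • ·) (a • ·) : Blocks m l → Blocks m l) :=
    (measurable_const_smul d).prodMap (measurable_const_smul a)
  rw [hcomp, ← Measure.map_map h2.measurable (hsm.comp h1.measurable),
    ← Measure.map_map hsm h1.measurable, h1.map_eq, hscale, Measure.map_smul, h2.map_eq]

/-- The Schur complement `A - B D⁻¹ C`. -/
noncomputable def schurCompl {m l : Type} [Fintype l] [DecidableEq l] (x : Blocks m l) :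
    Matrix m m ℝ :=
  of x.2 - of x.1.1 * (of x.1.2.2)⁻¹ * of x.1.2.1

theorem blocksEquiv_schurScale {m l : Type} [Fintype l] [DecidableEq l] (a d : ℝ)
    (x : Blocks m l) :
    blocksEquiv m l (schurScale a d x) =
      d • blocksEquiv m l x + (a - d) • fromBlocks (schurCompl x) 0 0 0 := by
  have h : of (schurScale a d x).2 = d • of x.2 + (a - d) • schurCompl x := by
    have : of (schurScale a d x).2 = a • schurCompl x + d • (of x.2 - schurCompl x) := by
      rw [schurCompl, sub_sub_cancel]
      rfl
    rw [this]
    module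
  change fromBlocks (of (schurScale a d x).2) (d • of x.1.1) (d • of x.1.2.1) (d • of x.1.2.2) =
    d • fromBlocks (of x.2) (of x.1.1) (of x.1.2.1) (of x.1.2.2) + _
  rw [h, fromBlocks_smul, fromBlocks_smul, fromBlocks_add]
  simp

theorem schurCompl_schurScale {a d : ℝ} (hd : d ≠ 0) {m l : Type} [Fintype l] [DecidableEq l]
    (x : Blocks m l) (hx : (of x.1.2.2).det ≠ 0) :
    schurCompl (schurScale a d x) = a • schurCompl x := by
  have : of (schurScale a d x).2 =
      a • schurCompl x + d • (of x.1.1 * (of x.1.2.2)⁻¹ * of x.1.2.1) := rfl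
  have hD : (d • of x.1.2.2)⁻¹ = d⁻¹ • (of x.1.2.2)⁻¹ :=
    let := invertibleOfNonzero hd
    Matrix.inv_smul _ d hx.isUnit
  rw [schurCompl, this]
  change _ - (d • of x.1.1) * (d • of x.1.2.2)⁻¹ * (d • of x.1.2.1) = _
  rw [hD, Matrix.smul_mul, Matrix.smul_mul, Matrix.mul_smul, Matrix.mul_smul, Matrix.smul_mul,
    smul_inv_smul₀ hd, add_sub_cancel_right]

theorem det_blocksEquiv [DecidableEq m] (x : Blocks m l) (hx : (of x.1.2.2).det ≠ 0) :
    (blocksEquiv m l x).det = (of x.1.2.2).det * (schurCompl x).det := by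
  let := invertibleOfIsUnitDet _ hx.isUnit
  change (fromBlocks (of x.2) (of x.1.1) (of x.1.2.1) (of x.1.2.2)).det = _
  rw [det_fromBlocks₂₂, invOf_eq_nonsing_inv, schurCompl]

/-- Two-sided multiplication of block matrices, on their entries. -/
def blocksMul {m l : Type} [Fintype m] [Fintype l] (p q : Matrix (m ⊕ l) (m ⊕ l) ℝ) : Blocks m l →ₗ[ℝ] Blocks m l :=
  ((blocksEquiv m l).symm : _ →ₗ[ℝ] _) ∘ₗ LinearMap.mulLeftRight ℝ (p, q) ∘ₗ
    ((blocksEquiv m l).symm.symm : _ →ₗ[ℝ] _)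

theorem blocksEquiv_blocksMul {m l : Type} [Fintype m] [Fintype l]
    (p q : Matrix (m ⊕ l) (m ⊕ l) ℝ) (x : Blocks m l) :
    blocksEquiv m l (blocksMul p q x) = p * blocksEquiv m l x * q := by
  simp [blocksMul]

theorem measurePreserving_blocksMul [DecidableEq m] {p q : Matrix (m ⊕ l) (m ⊕ l) ℝ}
    (hp : p.det = 1) (hq : q.det = 1) : MeasurePreserving (blocksMul p q : Blocks m l → _) := by
  have hdet : LinearMap.det (blocksMul p q) = 1 := by
    rw [blocksMul, LinearMap.det_conj, LinearMap.det_mulLeftRight_matrix, hp, hq]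
    simp
  refine ⟨(LinearMap.continuous_of_finiteDimensional _).measurable, ?_⟩
  rw [Measure.map_linearMap_addHaar_eq_smul_addHaar _ (by simp [hdet]), hdet]
  simp

section Triangular

variable {p q : Matrix (m ⊕ l) (m ⊕ l) ℝ}

theorem blocksMul_lowerRight {m l : Type} [Fintype m] [Fintype l]
    {p q : Matrix (m ⊕ l) (m ⊕ l) ℝ} (hp : p.toBlocks₂₁ = 0) (hq : q.toBlocks₁₂ = 0) (x : Blocks m l) :
    of (blocksMul p q x).1.2.2 = p.toBlocks₂₂ * of x.1.2.2 * q.toBlocks₂₂ := by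
  change (p * blocksEquiv m l x * q).toBlocks₂₂ = _
  rw [← fromBlocks_toBlocks p, ← fromBlocks_toBlocks q, hp, hq]
  simp [blocksEquiv_apply, fromBlocks_multiply]

theorem det_toBlocks₂₂_ne_zero_of_upper [DecidableEq m] (hp : p.toBlocks₂₁ = 0)
    (h : p.det ≠ 0) : p.toBlocks₂₂.det ≠ 0 := by
  rw [← fromBlocks_toBlocks p, hp, det_fromBlocks_zero₂₁] at h
  exact right_ne_zero_of_mul h

theorem det_toBlocks₂₂_ne_zero_of_lower [DecidableEq m] (hq : q.toBlocks₁₂ = 0)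
    (h : q.det ≠ 0) : q.toBlocks₂₂.det ≠ 0 := by
  rw [← fromBlocks_toBlocks q, hq, det_fromBlocks_zero₁₂] at h
  exact right_ne_zero_of_mul h

theorem schurCompl_blocksMul (hp : p.toBlocks₂₁ = 0) (hq : q.toBlocks₁₂ = 0)
    (hp' : p.toBlocks₂₂.det ≠ 0) (hq' : q.toBlocks₂₂.det ≠ 0) (x : Blocks m l)
    (hx : (of x.1.2.2).det ≠ 0) :
    schurCompl (blocksMul p q x) = p.toBlocks₁₁ * schurCompl x * q.toBlocks₁₁ := by
  rw [schurCompl, blocksMul_lowerRight hp hq]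
  change (p * blocksEquiv m l x * q).toBlocks₁₁ - (p * blocksEquiv m l x * q).toBlocks₁₂ * _ *
    (p * blocksEquiv m l x * q).toBlocks₂₁ = _
  rw [schurCompl]
  change (p * fromBlocks (of x.2) (of x.1.1) (of x.1.2.1) (of x.1.2.2) * q).toBlocks₁₁ -
    (p * fromBlocks (of x.2) (of x.1.1) (of x.1.2.1) (of x.1.2.2) * q).toBlocks₁₂ * _ *
    (p * fromBlocks (of x.2) (of x.1.1) (of x.1.2.1) (of x.1.2.2) * q).toBlocks₂₁ = _
  generalize of x.2 = A, of x.1.1 = B, of x.1.2.1 = C, of x.1.2.2 = D at *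
  nth_rw 1 2 4 [← fromBlocks_toBlocks p, ← fromBlocks_toBlocks q]
  rw [hp, hq]
  generalize p.toBlocks₁₁ = P₁, p.toBlocks₁₂ = P₂, p.toBlocks₂₂ = P₃, q.toBlocks₁₁ = Q₁,
    q.toBlocks₂₁ = Q₂, q.toBlocks₂₂ = Q₃ at *
  simp only [fromBlocks_multiply, toBlocks_fromBlocks₁₁, toBlocks_fromBlocks₁₂,
    toBlocks_fromBlocks₂₁, Matrix.mul_zero, Matrix.zero_mul, zero_add]
  have h : (P₁ * B + P₂ * D) * Q₃ * (P₃ * D * Q₃)⁻¹ * (P₃ * C * Q₁ + P₃ * D * Q₂) =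
      (P₁ * B * D⁻¹ + P₂) * (C * Q₁ + D * Q₂) := by
    have h1 : (P₁ * B + P₂ * D) = (P₁ * B * D⁻¹ + P₂) * D := by
      rw [Matrix.add_mul, nonsing_inv_mul_cancel_right _ _ hx.isUnit]
    have h2 : P₃ * C * Q₁ + P₃ * D * Q₂ = P₃ * (C * Q₁ + D * Q₂) := by
      simp only [Matrix.mul_add, Matrix.mul_assoc]
    rw [h1, h2, Matrix.mul_inv_rev, Matrix.mul_inv_rev]
    simp only [Matrix.mul_assoc]
    rw [mul_nonsing_inv_cancel_left _ _ hq'.isUnit, mul_nonsing_inv_cancel_left _ _ hx.isUnit,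
      nonsing_inv_mul_cancel_left _ _ hp'.isUnit]
  have h3 : P₁ * B * D⁻¹ * (D * Q₂) = P₁ * B * Q₂ := by
    rw [← Matrix.mul_assoc, nonsing_inv_mul_cancel_right _ _ hx.isUnit]
  rw [h, Matrix.add_mul (P₁ * B * D⁻¹), Matrix.mul_add (P₁ * B * D⁻¹), h3]
  simp only [Matrix.mul_add, Matrix.add_mul, Matrix.mul_sub, Matrix.sub_mul, Matrix.mul_assoc]
  abel

theorem schurScale_blocksMul (a d : ℝ) (hp : p.toBlocks₂₁ = 0) (hq : q.toBlocks₁₂ = 0)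
    (hp' : p.toBlocks₂₂.det ≠ 0) (hq' : q.toBlocks₂₂.det ≠ 0) (x : Blocks m l)
    (hx : (of x.1.2.2).det ≠ 0) :
    schurScale a d (blocksMul p q x) = blocksMul p q (schurScale a d x) := by
  apply (blocksEquiv m l).injective
  have h : p * fromBlocks (schurCompl x) 0 0 0 * q =
      fromBlocks (p.toBlocks₁₁ * schurCompl x * q.toBlocks₁₁) 0 0 0 := by
    conv_lhs => rw [← fromBlocks_toBlocks p, ← fromBlocks_toBlocks q, hp, hq]
    simp [fromBlocks_multiply]
  rw [blocksEquiv_schurScale, blocksEquiv_blocksMul, blocksEquiv_blocksMul,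
    blocksEquiv_schurScale, schurCompl_blocksMul hp hq hp' hq' x hx, ← h]
  simp [Matrix.mul_add, Matrix.add_mul]

end Triangular

/-- The block matrices with determinant in `(1, 2)` and invertible lower right block. -/
def bigCell (m l : Type) [Fintype m] [Fintype l] [DecidableEq m] [DecidableEq l] :
    Set (Blocks m l) :=
  {x | (blocksEquiv m l x).det ∈ Set.Ioo 1 2 ∧ (of x.1.2.2).det ≠ 0}

theorem isOpen_bigCell [DecidableEq m] : IsOpen (bigCell m l) := by
  have h1 : Continuous fun x : Blocks m l => (blocksEquiv m l x).det :=
    Continuous.matrix_det (blocksEquiv m l).toLinearMap.continuous_of_finiteDimensional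
  have h2 : Continuous fun x : Blocks m l => (of x.1.2.2).det :=
    Continuous.matrix_det (continuous_snd.comp (continuous_snd.comp continuous_fst))
  exact (isOpen_Ioo.preimage h1).inter (isOpen_ne.preimage h2)

theorem bigCell_nonempty [DecidableEq m] [Nonempty m] : (bigCell m l).Nonempty := by
  classical
  let i : m := Classical.arbitrary m
  refine ⟨(blocksEquiv m l).symm
    (fromBlocks (diagonal (Function.update (fun _ => (1 : ℝ)) i (3 / 2))) 0 0 1), ?_, ?_⟩
  · rw [LinearEquiv.apply_symm_apply, det_fromBlocks_zero₂₁, det_diagonal,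
      Finset.prod_update_of_mem (Finset.mem_univ i)]
    norm_num
  · change (det (1 : Matrix l l ℝ)) ≠ 0
    simp

theorem schurScale_mem_bigCell_iff [DecidableEq m] {a d : ℝ} (hd : d ≠ 0)
    (had : a ^ Fintype.card m * d ^ Fintype.card l = 1) (x : Blocks m l) :
    schurScale a d x ∈ bigCell m l ↔ x ∈ bigCell m l := by
  have hD : (of (schurScale a d x).1.2.2).det = d ^ Fintype.card l * (of x.1.2.2).det :=
    det_smul _ d
  have hD' : (of (schurScale a d x).1.2.2).det ≠ 0 ↔ (of x.1.2.2).det ≠ 0 := by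
    rw [hD]
    simp [hd]
  simp only [bigCell, Set.mem_ofPred_eq, hD']
  refine and_congr_left fun hx => ?_
  rw [det_blocksEquiv _ (hD'.2 hx), det_blocksEquiv _ hx, hD, schurCompl_schurScale hd _ hx,
    det_smul]
  have : d ^ Fintype.card l * (of x.1.2.2).det * (a ^ Fintype.card m * (schurCompl x).det) =
      (a ^ Fintype.card m * d ^ Fintype.card l) * ((of x.1.2.2).det * (schurCompl x).det) := by
    ring
  rw [this, had, one_mul]

theorem blocksMul_mem_bigCell_iff [DecidableEq m] {p q : Matrix (m ⊕ l) (m ⊕ l) ℝ}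
    (hp : p.toBlocks₂₁ = 0) (hq : q.toBlocks₁₂ = 0) (hp' : p.det = 1) (hq' : q.det = 1)
    (x : Blocks m l) : blocksMul p q x ∈ bigCell m l ↔ x ∈ bigCell m l := by
  have h1 := det_toBlocks₂₂_ne_zero_of_upper hp (by simp [hp'])
  have h2 := det_toBlocks₂₂_ne_zero_of_lower hq (by simp [hq'])
  simp only [bigCell, Set.mem_ofPred_eq, blocksMul_lowerRight hp hq, blocksEquiv_blocksMul,
    det_mul, hp', hq']
  simp [h1, h2]

/-- Opposite block-triangular actions on the matrices of determinant one admit no compact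
set which meets every orbit in finitely many group elements. -/
theorem not_exists_isCompact_of_block_triangular [DecidableEq m] [Nonempty m] [Nonempty l]
    {Γ : Type*} [Group Γ] [Countable Γ] (p q : Γ →* Matrix (m ⊕ l) (m ⊕ l) ℝ)
    (hp : ∀ γ, (p γ).toBlocks₂₁ = 0) (hq : ∀ γ, (q γ).toBlocks₁₂ = 0)
    (hp' : ∀ γ, (p γ).det = 1) (hq' : ∀ γ, (q γ).det = 1) :
    ¬ ∃ C : Set (Matrix (m ⊕ l) (m ⊕ l) ℝ), IsCompact C ∧ (∀ c ∈ C, c.det = 1) ∧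
      ∀ x : Matrix (m ⊕ l) (m ⊕ l) ℝ, x.det = 1 →
        {γ | p γ * x * q γ⁻¹ ∈ C}.Finite ∧ {γ | p γ * x * q γ⁻¹ ∈ C}.Nonempty := by
  rintro ⟨C, hC, hCdet, hCx⟩
  let : MulAction Γ (Blocks m l) :=
    { smul := fun γ x => blocksMul (p γ) (q γ⁻¹) x
      one_smul := fun x => (blocksEquiv m l).injective <| by
        change blocksEquiv m l (blocksMul (p 1) (q 1⁻¹) x) = _
        simp [blocksEquiv_blocksMul]
      mul_smul := fun γ δ x => (blocksEquiv m l).injective <| by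
        change blocksEquiv m l (blocksMul (p (γ * δ)) (q (γ * δ)⁻¹) x) =
          blocksEquiv m l (blocksMul (p γ) (q γ⁻¹) (blocksMul (p δ) (q δ⁻¹) x))
        simp [blocksEquiv_blocksMul, Matrix.mul_assoc] }
  have smul_def : ∀ (γ : Γ) (x : Blocks m l), γ • x = blocksMul (p γ) (q γ⁻¹) x := fun _ _ => rfl
  have hmp : ∀ γ : Γ, MeasurePreserving (γ • · : Blocks m l → Blocks m l) := fun γ =>
    measurePreserving_blocksMul (hp' γ) (hq' γ⁻¹)
  have : MeasurableConstSMul Γ (Blocks m l) := ⟨fun γ => (hmp γ).measurable⟩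
  have hU : MeasurableSet (bigCell m l) := isOpen_bigCell.measurableSet
  have : SMulInvariantMeasure Γ (Blocks m l) (volume.restrict (bigCell m l)) := by
    refine ⟨fun γ s hs => ?_⟩
    have h := (hmp γ).restrict_preimage hU
    have hpre : (γ • · : Blocks m l → Blocks m l) ⁻¹' bigCell m l = bigCell m l :=
      Set.ext fun x => blocksMul_mem_bigCell_iff (hp γ) (hq γ⁻¹) (hp' γ) (hq' γ⁻¹) x
    rw [hpre] at h
    exact h.measure_preimage hs.nullMeasurableSet
  let Ct : Set (Blocks m l) :=
    (fun z : ℝ × Matrix (m ⊕ l) (m ⊕ l) ℝ => z.1 • (blocksEquiv m l).symm z.2) ''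
      (Set.Icc 1 2 ×ˢ C)
  have hCt : IsCompact Ct := (isCompact_Icc.prod hC).image <| continuous_fst.smul <|
    (blocksEquiv m l).symm.toLinearMap.continuous_of_finiteDimensional.comp continuous_snd
  set n := Fintype.card (m ⊕ l) with hn
  have hn0 : n ≠ 0 := Fintype.card_ne_zero
  have horbit : ∀ x ∈ bigCell m l, ∃ y : Matrix (m ⊕ l) (m ⊕ l) ℝ, y.det = 1 ∧
      ∀ γ : Γ, γ • x ∈ Ct ↔ p γ * y * q γ⁻¹ ∈ C := by
    rintro x ⟨⟨h1, h2⟩, -⟩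
    set D := (blocksEquiv m l x).det
    set r := D ^ (n⁻¹ : ℝ) with hr
    have hrn : r ^ n = D := Real.rpow_inv_natCast_pow (by linarith) hn0
    have hr1 : 1 ≤ r := Real.one_le_rpow h1.le (by positivity)
    have hr2 : r ≤ 2 := by
      have : r ≤ r ^ n := le_self_pow₀ hr1 hn0
      linarith
    have hr0 : r ≠ 0 := by linarith
    have hsmul : ∀ γ : Γ, γ • x =
        r • (blocksEquiv m l).symm (p γ * (r⁻¹ • blocksEquiv m l x) * q γ⁻¹) := fun γ => by
      apply (blocksEquiv m l).injective
      rw [smul_def, blocksEquiv_blocksMul]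
      simp [smul_smul, hr0]
    have hydet : (r⁻¹ • blocksEquiv m l x).det = 1 := by
      rw [det_smul, ← hn, inv_pow, hrn]
      exact inv_mul_cancel₀ (by linarith)
    refine ⟨r⁻¹ • blocksEquiv m l x, hydet, fun γ => ⟨?_, fun h => ?_⟩⟩
    · rintro ⟨⟨s, c⟩, ⟨⟨hs1, -⟩, hc⟩, hsc⟩
      have heq : s • c = r • (p γ * (r⁻¹ • blocksEquiv m l x) * q γ⁻¹) := by
        have := congrArg (blocksEquiv m l) (hsc.trans (hsmul γ))
        simpa only [map_smul, LinearEquiv.apply_symm_apply] using this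
      have hdet := congrArg det heq
      rw [det_smul, det_smul, hCdet c hc, det_mul, det_mul, hp', hq', hydet, ← hn] at hdet
      have hsr : s = r := by
        have hs1 : 1 ≤ s := hs1
        exact (pow_left_inj₀ (by linarith) (by linarith) hn0).1 (by simpa using hdet)
      subst hsr
      rw [← smul_right_injective _ hr0 heq]
      exact hc
    · rw [hsmul]
      exact ⟨(r, _), ⟨⟨hr1, hr2⟩, h⟩, rfl⟩
  set a : ℝ := 2 ^ Fintype.card l with ha
  set d : ℝ := (2 ^ Fintype.card m)⁻¹ with hd
  have ha0 : a ≠ 0 := by positivity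
  have hd0 : d ≠ 0 := by positivity
  have had : a ^ Fintype.card m * d ^ Fintype.card l = 1 := by
    rw [ha, hd, inv_pow, ← pow_mul, ← pow_mul, mul_comm (Fintype.card l)]
    exact mul_inv_cancel₀ (by positivity)
  have hpre : schurScale a d ⁻¹' bigCell m l = bigCell m l :=
    Set.ext fun x => schurScale_mem_bigCell_iff hd0 had x
  have hmap := Measure.restrict_map (μ := (volume : Measure (Blocks m l)))
    (measurable_schurScale a d) hU
  rw [hpre, map_schurScale ha0 hd0, Measure.restrict_smul] at hmap
  have hone := eq_one_of_map_eq_smul_of_finite_covolume (Γ := Γ) (C := Ct)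
    (ν := volume.restrict (bigCell m l)) hCt.measurableSet
    ((Measure.restrict_apply_le _ _).trans_lt hCt.measure_lt_top).ne
    (by
      rw [Ne, Measure.restrict_eq_zero]
      exact (isOpen_bigCell.measure_pos _ bigCell_nonempty).ne')
    ((ae_restrict_iff' hU).2 <| ae_of_all _ fun x hx => by
      obtain ⟨y, hy, h⟩ := horbit x hx
      simpa only [h] using (hCx y hy).2)
    ((ae_restrict_iff' hU).2 <| ae_of_all _ fun x hx => by
      obtain ⟨y, hy, h⟩ := horbit x hx
      simpa only [h] using (hCx y hy).1)
    (measurable_schurScale a d)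
    ((ae_restrict_iff' hU).2 <| ae_of_all _ fun x hx γ =>
      schurScale_blocksMul a d (hp γ) (hq γ⁻¹)
        (det_toBlocks₂₂_ne_zero_of_upper (hp γ) (by simp [hp']))
        (det_toBlocks₂₂_ne_zero_of_lower (hq γ⁻¹) (by simp [hq'])) x hx.2)
    hmap.symm
  have hcard : Fintype.card m * (2 * (Fintype.card m * Fintype.card l) +
      Fintype.card l * Fintype.card l) = Fintype.card l * (Fintype.card m * Fintype.card m) := by
    rw [ENNReal.ofReal_eq_one, abs_of_pos (by positivity), inv_eq_one, ha, hd, inv_pow,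
      ← pow_mul, ← pow_mul, inv_mul_eq_one₀ (by positivity)] at hone
    exact pow_right_injective₀ (by norm_num) (by norm_num) hone
  have hm : 0 < Fintype.card m := Fintype.card_pos
  have hl : 0 < Fintype.card l := Fintype.card_pos
  have : 0 < Fintype.card m * Fintype.card l * (Fintype.card m + Fintype.card l) := by positivity
  nlinarith

end Block

section Adapted

variable {n : ℕ} {S T : Submodule ℝ (Fin n → ℝ)}

/-- A basis adapted to a decomposition into complementary subspaces. -/
noncomputable def adaptedBasis (h : IsCompl S T) :
    Module.Basis (Fin (Module.finrank ℝ S) ⊕ Fin (Module.finrank ℝ T)) ℝ (Fin n → ℝ) :=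
  ((Module.finBasis ℝ S).prod (Module.finBasis ℝ T)).map (S.prodEquivOfIsCompl T h)

/-- Change of coordinates on matrices to the adapted basis. -/
noncomputable def adaptedMatrix (h : IsCompl S T) :
    Matrix (Fin n) (Fin n) ℝ ≃ₐ[ℝ]
      Matrix (Fin (Module.finrank ℝ S) ⊕ Fin (Module.finrank ℝ T))
        (Fin (Module.finrank ℝ S) ⊕ Fin (Module.finrank ℝ T)) ℝ :=
  Matrix.toLinAlgEquiv'.trans (LinearMap.toMatrixAlgEquiv (adaptedBasis h))

theorem det_adaptedMatrix (h : IsCompl S T) (x : Matrix (Fin n) (Fin n) ℝ) :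
    (adaptedMatrix h x).det = x.det :=
  (LinearMap.det_toMatrix (adaptedBasis h) (Matrix.toLin' x)).trans (LinearMap.det_toLin' x)

theorem toBlocks₂₁_adaptedMatrix (h : IsCompl S T) {x : Matrix (Fin n) (Fin n) ℝ}
    (hx : S.map x.mulVecLin ≤ S) : (adaptedMatrix h x).toBlocks₂₁ = 0 := by
  ext i j
  have hmem : x.mulVecLin (Module.finBasis ℝ S j : Fin n → ℝ) ∈ S :=
    hx (Submodule.mem_map_of_mem (Module.finBasis ℝ S j).2)
  rw [mulVecLin_apply] at hmem
  simp [adaptedMatrix, adaptedBasis, toBlocks₂₁, LinearMap.toMatrixAlgEquiv_apply,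
    (Submodule.projectionOnto_apply_eq_zero_iff _).2 hmem]

theorem toBlocks₁₂_adaptedMatrix (h : IsCompl S T) {x : Matrix (Fin n) (Fin n) ℝ}
    (hx : T.map x.mulVecLin ≤ T) : (adaptedMatrix h x).toBlocks₁₂ = 0 := by
  ext i j
  have hmem : x.mulVecLin (Module.finBasis ℝ T j : Fin n → ℝ) ∈ T :=
    hx (Submodule.mem_map_of_mem (Module.finBasis ℝ T j).2)
  rw [mulVecLin_apply] at hmem
  simp [adaptedMatrix, adaptedBasis, toBlocks₁₂, LinearMap.toMatrixAlgEquiv_apply,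
    (Submodule.projectionOnto_apply_eq_zero_iff _).2 hmem]

end Adapted

instance (n : ℕ) : SecondCountableTopology (SpecialLinearGroup (Fin n) ℝ) :=
  have : SecondCountableTopology (Matrix (Fin n) (Fin n) ℝ) :=
    inferInstanceAs (SecondCountableTopology (Fin n → Fin n → ℝ))
  TopologicalSpace.secondCountableTopology_induced _ _ _

/-- **Theorem 7.1 (last statement) for `G = SL(n,ℝ)`.**  Let `P` be the parabolic subgroup
preserving a (partial) flag `V₁ ⊊ … ⊊ V_k` (with `V₁ ≠ 0`, `V_k ≠ ℝⁿ`) and `P⁻` the opposite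
parabolic subgroup preserving complementary subspaces `W₁ ⊋ … ⊋ W_k` (with
`dim W_i = n − dim V_i` and `V_i ∩ W_i = 0`).  Then no discrete subgroup of `P × P⁻` can act
properly discontinuously and cocompactly on `SL(n,ℝ)` by `(p,q)·x = p x q⁻¹`. -/
theorem no_proper_cocompact_action_of_opposite_parabolics
    (n k : ℕ) (hn : 2 ≤ n) (hk : 1 ≤ k)
    (V W : Fin k → Submodule ℝ (Fin n → ℝ))
    (hVmono : StrictMono V)
    (hV1 : V ⟨0, by omega⟩ ≠ ⊥)
    (hVk : V ⟨k - 1, by omega⟩ ≠ ⊤)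
    (hdim : ∀ i, Module.finrank ℝ (W i) = n - Module.finrank ℝ (V i))
    (hcompl : ∀ i, V i ⊓ W i = ⊥)
    (P Pm : Subgroup (SpecialLinearGroup (Fin n) ℝ))
    (hP : ∀ g : SpecialLinearGroup (Fin n) ℝ, g ∈ P ↔
      ∀ i, Submodule.map (g : Matrix (Fin n) (Fin n) ℝ).mulVecLin (V i) = V i)
    (hPm : ∀ g : SpecialLinearGroup (Fin n) ℝ, g ∈ Pm ↔
      ∀ i, Submodule.map (g : Matrix (Fin n) (Fin n) ℝ).mulVecLin (W i) = W i) :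
    ¬ ∃ Γ : Subgroup (SpecialLinearGroup (Fin n) ℝ × SpecialLinearGroup (Fin n) ℝ),
      Γ ≤ P.prod Pm ∧ DiscreteTopology Γ ∧
      (∀ K : Set (SpecialLinearGroup (Fin n) ℝ), IsCompact K →
        {γ : Γ | ((fun x => (γ : SpecialLinearGroup (Fin n) ℝ × SpecialLinearGroup (Fin n) ℝ).1
            * x * (γ : SpecialLinearGroup (Fin n) ℝ × SpecialLinearGroup (Fin n) ℝ).2⁻¹) '' K
          ∩ K).Nonempty}.Finite) ∧
      (∃ C : Set (SpecialLinearGroup (Fin n) ℝ), IsCompact C ∧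
        ∀ x : SpecialLinearGroup (Fin n) ℝ, ∃ γ : Γ, ∃ c ∈ C,
          x = (γ : SpecialLinearGroup (Fin n) ℝ × SpecialLinearGroup (Fin n) ℝ).1 * c
            * (γ : SpecialLinearGroup (Fin n) ℝ × SpecialLinearGroup (Fin n) ℝ).2⁻¹) := by
  rintro ⟨Γ, hΓ, hdisc, hproper, C, hC, hcover⟩
  set S := V ⟨0, by omega⟩
  set T := W ⟨0, by omega⟩
  have hST : S ≠ ⊤ := fun h => hVk <| top_le_iff.1 <| h.ge.trans <|
    hVmono.monotone (Nat.zero_le _)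
  have hle : Module.finrank ℝ S ≤ n := by simpa using S.finrank_le
  have hdimT : Module.finrank ℝ T = n - Module.finrank ℝ S := hdim _
  have hcom : IsCompl S T := (Submodule.isCompl_iff_disjoint S T (by
    rw [Module.finrank_fin_fun, hdimT]
    omega)).2 (disjoint_iff.2 (hcompl _))
  have hT : T ≠ ⊥ := fun h => hST <| by
    have := hcom.sup_eq_top
    rwa [h, sup_bot_eq] at this
  have : Nontrivial S := Submodule.nontrivial_iff_ne_bot.2 hV1
  have : Nontrivial T := Submodule.nontrivial_iff_ne_bot.2 hT
  have : Nonempty (Fin (Module.finrank ℝ S)) := Fin.pos_iff_nonempty.1 Module.finrank_pos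
  have : Nonempty (Fin (Module.finrank ℝ T)) := Fin.pos_iff_nonempty.1 Module.finrank_pos
  have : Countable Γ := TopologicalSpace.separableSpace_iff_countable.1 inferInstance
  let ψ := (adaptedMatrix hcom).toMulEquiv.toMonoidHom.comp
    (SpecialLinearGroup.coeMonoidHom : SpecialLinearGroup (Fin n) ℝ →* _)
  have hψdet : ∀ g, (ψ g).det = 1 := fun g => (det_adaptedMatrix hcom _).trans g.2
  have hψinj : Function.Injective ψ := fun g g' h =>
    Subtype.ext ((adaptedMatrix hcom).injective h)
  have hψcont : Continuous ψ :=
    (adaptedMatrix hcom).toLinearMap.continuous_of_finiteDimensional.comp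
      continuous_induced_dom
  refine not_exists_isCompact_of_block_triangular
    (ψ.comp ((MonoidHom.fst _ _).comp Γ.subtype)) (ψ.comp ((MonoidHom.snd _ _).comp Γ.subtype))
    (fun γ => toBlocks₂₁_adaptedMatrix hcom ((hP _).1 (hΓ γ.2).1 _).le)
    (fun γ => toBlocks₁₂_adaptedMatrix hcom ((hPm _).1 (hΓ γ.2).2 _).le)
    (fun γ => hψdet _) (fun γ => hψdet _)
    ⟨ψ '' C, hC.image hψcont, Set.forall_mem_image.2 fun g _ => hψdet g, fun x hx => ?_⟩
  obtain ⟨y, rfl⟩ : ∃ y, ψ y = x :=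
    ⟨⟨(adaptedMatrix hcom).symm x, by
      rw [← det_adaptedMatrix hcom, AlgEquiv.apply_symm_apply, hx]⟩,
      (adaptedMatrix hcom).apply_symm_apply x⟩
  have hmem : ∀ γ : Γ, ψ γ.1.1 * ψ y * ψ (γ⁻¹).1.2 ∈ ψ '' C ↔ γ.1.1 * y * γ.1.2⁻¹ ∈ C :=
    fun γ => by
      rw [← map_mul, ← map_mul, hψinj.mem_set_image]
      rfl
  refine ⟨(hproper (insert y C) (hC.insert y)).subset fun γ hγ => ?_, ?_⟩
  · exact ⟨_, ⟨y, Set.mem_insert _ _, rfl⟩, Set.mem_insert_of_mem _ ((hmem γ).1 hγ)⟩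
  · obtain ⟨γ, c, hc, hyc⟩ := hcover y
    refine ⟨γ⁻¹, (hmem γ⁻¹).2 ?_⟩
    rw [hyc]
    simpa [mul_assoc] using hc
end

section
/- Let X be a topological space and Γ a group acting on X, and suppose there is a compact subset C₀ of X with Γ·C₀ = X. Let d : X × X → ℝ be a continuous, nonnegative, Γ-invariant function satisfying the triangle inequality d(x,z) ≤ d(x,y) + d(y,z) for all x,y,z. Let Δ : X × X → ℝ be a nonnegative Γ-invariant function such that: (i) for every compact subset C of X, the set {y ∈ X : there exists x ∈ C with Δ(x,y) ≤ 1} is compact; and (ii) for all x, y ∈ X and all t ∈ [0,1] there exists z ∈ X with Δ(x,z) ≤ t·Δ(x,y) and Δ(z,y) ≤ (1−t)·Δ(x,y). Then there exists R ≥ 1 such that Δ(x,y) ≥ R⁻¹·d(x,y) − 1 for all x, y ∈ X. (Abstract form of Proposition 3.8: any function Δ with the properties established in Lemmas 3.6 and 3.7 is coarsely bounded below by any continuous invariant distance, provided the action is cocompact.) -/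
/-- **Proposition 3.8 (abstract form).**  Let `Γ` act cocompactly on `X`, let `d` be a
continuous, nonnegative, `Γ`-invariant function satisfying the triangle inequality, and let
`Δ` be a nonnegative `Γ`-invariant function satisfying the conclusions of Lemmas 3.6 and
3.7.  Then `Δ` is coarsely bounded below by `d`:  there is `R ≥ 1` with
`Δ(x,y) ≥ R⁻¹·d(x,y) − 1` for all `x, y`. -/
theorem svarc_milnor_for_Delta
    {X : Type*} [TopologicalSpace X] {Γ : Type*} [Group Γ] [MulAction Γ X]
    (C₀ : Set X) (hC₀ : IsCompact C₀)
    (hcover : ∀ x : X, ∃ γ : Γ, ∃ c ∈ C₀, x = γ • c)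
    (d : X → X → ℝ)
    (hd_cont : Continuous fun p : X × X => d p.1 p.2)
    (hd_nonneg : ∀ x y, 0 ≤ d x y)
    (hd_inv : ∀ (γ : Γ) (x y : X), d (γ • x) (γ • y) = d x y)
    (hd_tri : ∀ x y z : X, d x z ≤ d x y + d y z)
    (Δ : X → X → ℝ)
    (hΔ_nonneg : ∀ x y, 0 ≤ Δ x y)
    (hΔ_inv : ∀ (γ : Γ) (x y : X), Δ (γ • x) (γ • y) = Δ x y)
    (hΔ_compact : ∀ C : Set X, IsCompact C → IsCompact {y : X | ∃ x ∈ C, Δ x y ≤ 1})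
    (hΔ_interp : ∀ x y : X, ∀ t ∈ Set.Icc (0:ℝ) 1,
      ∃ z : X, Δ x z ≤ t * Δ x y ∧ Δ z y ≤ (1 - t) * Δ x y) :
    ∃ R : ℝ, 1 ≤ R ∧ ∀ x y : X, Δ x y ≥ R⁻¹ * d x y - 1 := by
  obtain ⟨R, hR1, hR⟩ : ∃ R : ℝ, 1 ≤ R ∧ ∀ x y : X, Δ x y ≤ 1 → d x y ≤ R := by
    obtain ⟨M, hM⟩ := ((hC₀.prod (hΔ_compact C₀ hC₀)).image hd_cont).bddAbove
    refine ⟨max 1 M, le_max_left _ _, fun x y hxy => ?_⟩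
    obtain ⟨γ, c, hc, rfl⟩ := hcover x
    have hΔ : Δ c (γ⁻¹ • y) ≤ 1 := by
      rwa [← hΔ_inv γ, smul_inv_smul]
    have hd : d c (γ⁻¹ • y) ≤ M := hM ⟨(c, γ⁻¹ • y), ⟨hc, c, hc, hΔ⟩, rfl⟩
    rw [← hd_inv γ, smul_inv_smul] at hd
    exact hd.trans (le_max_right _ _)
  have hstep : ∀ (n : ℕ) (x y : X), Δ x y ≤ n + 1 → d x y ≤ (n + 1) * R := by
    intro n
    induction n with
    | zero =>
      intro x y h
      simpa using hR x y (by simpa using h)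
    | succ n ih =>
      intro x y h
      push_cast at h ⊢
      have hn : (0 : ℝ) < n + 1 + 1 := by positivity
      have ht : (1 : ℝ) / (n + 1 + 1) ≤ 1 := by
        rw [div_le_one hn]
        linarith [n.cast_nonneg (α := ℝ)]
      obtain ⟨z, hxz, hzy⟩ := hΔ_interp x y (1 / (n + 1 + 1)) ⟨by positivity, ht⟩
      have h₁ : Δ x z ≤ 1 := hxz.trans <| by
        rw [one_div_mul_eq_div, div_le_one hn]
        exact h
      have h₂ : Δ z y ≤ n + 1 := hzy.trans <| by
        calc (1 - 1 / ((n : ℝ) + 1 + 1)) * Δ x y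
            ≤ (1 - 1 / ((n : ℝ) + 1 + 1)) * (n + 1 + 1) :=
              mul_le_mul_of_nonneg_left h (sub_nonneg.2 ht)
          _ = n + 1 := by field_simp; ring
      linarith [hd_tri x z y, hR x z h₁, ih z y h₂]
  refine ⟨R, hR1, fun x y => ?_⟩
  have hR0 : 0 < R := by linarith
  have hd := hstep ⌊Δ x y⌋₊ x y (Nat.lt_floor_add_one _).le
  have hd' : d x y ≤ R * (Δ x y + 1) := hd.trans <| by
    rw [mul_comm]
    gcongr
    exact Nat.floor_le (hΔ_nonneg x y)
  have := (inv_mul_le_iff₀ hR0).2 hd'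
  linarith
end

section
/- Let V be a real inner product space and let α, φ ∈ V with ⟨φ, α⟩ > 0. Define s_αφ := φ − (2⟨φ,α⟩/⟨α,α⟩)·α. Let C be a connected subset of V such that ⟨φ, x⟩ > 0 and ⟨s_αφ, x⟩ ≠ 0 for every x ∈ C, and suppose the closure of C contains a point y with ⟨φ, y⟩ = 0 and ⟨α, y⟩ > 0. Then ⟨α, x⟩ > 0 for every x ∈ C. (This is Lemma 4.9 of the paper, with the hypothesis that the closure of C meets Ker(φ) made precise: the closure point is required to lie outside Ker(α).) -/
open RealInnerProductSpace

/-- **Lemma 4.9.**  Let `α, φ` be vectors of a real inner product space with `⟪φ, α⟫ > 0`,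
and let `s_αφ = φ − (2⟪φ,α⟫/⟪α,α⟫)α` be the image of `φ` under the reflection in `α^⊥`.
Let `C` be a connected subset on which `⟪φ, ·⟫ > 0` and `⟪s_αφ, ·⟫ ≠ 0`, whose closure
contains a point `y` with `⟪φ, y⟫ = 0` and `⟪α, y⟫ > 0`.  Then `⟪α, ·⟫ > 0` on `C`. -/
theorem lemma_4_9
    {V : Type*} [NormedAddCommGroup V] [InnerProductSpace ℝ V]
    (α φ : V) (hφα : 0 < ⟪φ, α⟫)
    (C : Set V) (hC : IsPreconnected C)
    (hφpos : ∀ x ∈ C, 0 < ⟪φ, x⟫)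
    (hsα : ∀ x ∈ C, ⟪φ - (2 * ⟪φ, α⟫ / ⟪α, α⟫) • α, x⟫ ≠ 0)
    (y : V) (hy : y ∈ closure C) (hyφ : ⟪φ, y⟫ = 0) (hyα : 0 < ⟪α, y⟫) :
    ∀ x ∈ C, 0 < ⟪α, x⟫ := by
  have hα : 0 < ⟪α, α⟫ := real_inner_self_pos.2 fun h => by simp [h] at hφα
  have hk : 0 < 2 * ⟪φ, α⟫ / ⟪α, α⟫ := by positivity
  set k := 2 * ⟪φ, α⟫ / ⟪α, α⟫
  have hinner (v : V) : ⟪φ - k • α, v⟫ = ⟪φ, v⟫ - k * ⟪α, v⟫ := by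
    rw [inner_sub_left, real_inner_smul_left]
  have hcont : Continuous fun v : V => ⟪φ - k • α, v⟫ := by fun_prop
  have hyneg : ⟪φ - k • α, y⟫ < 0 := by
    rw [hinner, hyφ]
    linarith [mul_pos hk hyα]
  obtain ⟨z, hzneg, hzC⟩ :=
    mem_closure_iff.1 hy _ (isOpen_Iio.preimage hcont) hyneg
  intro x hx
  by_contra! hxα
  have hxpos : 0 ≤ ⟪φ - k • α, x⟫ := by
    rw [hinner]
    linarith [hφpos x hx, mul_nonpos_of_nonneg_of_nonpos hk.le hxα]
  obtain ⟨w, hwC, hw⟩ :=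
    hC.intermediate_value hzC hx hcont.continuousOn ⟨le_of_lt hzneg, hxpos⟩
  exact hsα w hwC hw
end

section
/- Let V be a real vector space, C ⊆ V a convex cone with C ∩ (−C) = {0}, and ι : V → V a linear involution with ι(C) = C. Suppose v₀ ∈ C ∖ {0} is such that the set of fixed points of ι lying in C is exactly ℝ≥0·v₀. Let L ⊆ C × C be a convex cone (closed under addition and under multiplication by positive scalars) that is invariant under the map (x,y) ↦ (ι(x), ι(y)). If L contains (v, 0) and (0, w) for some nonzero v, w ∈ C, then (v₀, v₀) ∈ L. (This is the key convex-geometry step in the proof of Proposition 8.1, applied there to the limit cone of a discrete subgroup of G₀ × G₀ with G₀ of restricted root system type A₂, where the opposition involution ι has one-dimensional fixed locus.) -/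
/-- In a salient cone preserved by an involution whose fixed points in the cone form the ray
through `v₀`, the sum of a nonzero element and its image is a positive multiple of `v₀`. -/
theorem exists_pos_add_involution_eq_smul
    {V : Type*} [AddCommGroup V] [Module ℝ V] {C : Set V}
    (hC_add : ∀ x ∈ C, ∀ y ∈ C, x + y ∈ C)
    (hC_salient : ∀ x, x ∈ C → -x ∈ C → x = 0)
    {ι : V →ₗ[ℝ] V} (hι_inv : ∀ x, ι (ι x) = x) (hιC : ι '' C = C) {v₀ : V}
    (hfix : {x | x ∈ C ∧ ι x = x} = {x | ∃ t : ℝ, 0 ≤ t ∧ x = t • v₀})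
    {v : V} (hvC : v ∈ C) (hv : v ≠ 0) :
    ∃ t : ℝ, 0 < t ∧ v + ι v = t • v₀ := by
  have hιv : ι v ∈ C := hιC ▸ Set.mem_image_of_mem ι hvC
  have hmem : v + ι v ∈ {x | x ∈ C ∧ ι x = x} :=
    ⟨hC_add _ hvC _ hιv, by rw [map_add, hι_inv, add_comm]⟩
  rw [hfix] at hmem
  obtain ⟨t, ht, h⟩ := hmem
  refine ⟨t, ht.lt_of_ne ?_, h⟩
  rintro rfl
  rw [zero_smul] at h
  exact hv (hC_salient v hvC (neg_eq_of_add_eq_zero_right h ▸ hιv))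

/-- **Key convex-geometry step in the proof of Proposition 8.1.**  Let `C` be a salient
convex cone in a real vector space, `ι` a linear involution preserving `C` whose fixed
points in `C` are exactly `ℝ≥0·v₀` for some nonzero `v₀ ∈ C`.  If a convex cone
`L ⊆ C × C` invariant under `(x,y) ↦ (ι x, ι y)` contains `(v,0)` and `(0,w)` for some
nonzero `v, w ∈ C`, then `(v₀, v₀) ∈ L`. -/
theorem limit_cone_meets_diagonal
    {V : Type*} [AddCommGroup V] [Module ℝ V]
    (C : Set V)
    (hC_add : ∀ x ∈ C, ∀ y ∈ C, x + y ∈ C)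
    (hC_smul : ∀ t : ℝ, 0 < t → ∀ x ∈ C, t • x ∈ C)
    (hC_salient : ∀ x, x ∈ C → -x ∈ C → x = 0)
    (ι : V →ₗ[ℝ] V) (hι_inv : ∀ x, ι (ι x) = x) (hιC : ι '' C = C)
    (v₀ : V) (hv₀C : v₀ ∈ C) (hv₀ : v₀ ≠ 0)
    (hfix : {x | x ∈ C ∧ ι x = x} = {x | ∃ t : ℝ, 0 ≤ t ∧ x = t • v₀})
    (L : Set (V × V)) (hL_sub : L ⊆ C ×ˢ C)
    (hL_add : ∀ p ∈ L, ∀ q ∈ L, p + q ∈ L)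
    (hL_smul : ∀ t : ℝ, 0 < t → ∀ p ∈ L, t • p ∈ L)
    (hL_inv : ∀ p ∈ L, (ι p.1, ι p.2) ∈ L)
    (v w : V) (hvC : v ∈ C) (hv : v ≠ 0) (hwC : w ∈ C) (hw : w ≠ 0)
    (hvL : ((v, 0) : V × V) ∈ L) (hwL : ((0, w) : V × V) ∈ L) :
    ((v₀, v₀) : V × V) ∈ L := by
  obtain ⟨a, ha, hva⟩ :=
    exists_pos_add_involution_eq_smul hC_add hC_salient hι_inv hιC hfix hvC hv
  obtain ⟨b, hb, hwb⟩ :=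
    exists_pos_add_involution_eq_smul hC_add hC_salient hι_inv hιC hfix hwC hw
  have h₁ := hL_smul a⁻¹ (inv_pos.2 ha) _ (hL_add _ hvL _ (hL_inv _ hvL))
  have h₂ := hL_smul b⁻¹ (inv_pos.2 hb) _ (hL_add _ hwL _ (hL_inv _ hwL))
  simpa [hva, hwb, smul_smul, ha.ne', hb.ne', -smul_add] using hL_add _ h₁ _ h₂
end
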